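/- Let T > 0, σ_Y > 0, γ° > 0, let α : [0,T] → ℝ be continuous with α(t) ≥ 1/2 for all t, and let γ : [0,T] → ℝ be C¹ with γ(0) = γ° and γ'(t) = −α(t)²·γ(t)²/σ_Y² on [0,T]. Then γ(t) > 0 for all t ∈ [0,T], and γ(T) ≤ 4σ_Y²γ°/(4σ_Y² + γ°T). In particular γ(T) → 0 as T → ∞. -/

import Mathlib

open Set Filter

/-- A solution of the linear equation `γ' = -c γ` with continuous coefficient that starts at a
positive value stays positive. -/
lemma pos_of_hasDerivWithinAt_neg_mul {T : ℝ} (hT : 0 ≤ T) {c γ : ℝ → ℝ}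
    (hc : ContinuousOn c (Icc 0 T)) (hγ0 : 0 < γ 0)
    (hγ : ∀ t ∈ Icc (0:ℝ) T, HasDerivWithinAt γ (-c t * γ t) (Icc 0 T) t) :
    ∀ t ∈ Icc (0:ℝ) T, 0 < γ t := by
  set C : ℝ → ℝ := IccExtend hT ((Icc 0 T).domRestrict c) with hC
  have hCcont : Continuous C := (continuousOn_iff_continuous_domRestrict.1 hc).Icc_extend'
  have hCeq : ∀ t ∈ Icc (0:ℝ) T, C t = c t := fun t ht => by
    rw [hC, IccExtend_of_mem hT _ ht]
    rfl
  set F : ℝ → ℝ := fun t => ∫ s in (0:ℝ)..t, C s with hF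
  have hFderiv : ∀ t, HasDerivAt F (C t) t := fun t =>
    hCcont.integral_hasStrictDerivAt 0 t |>.hasDerivAt
  have hG : ∀ t ∈ Icc (0:ℝ) T,
      HasDerivWithinAt (fun t => γ t * Real.exp (F t)) 0 (Icc 0 T) t := fun t ht => by
    have h := (hγ t ht).mul (hFderiv t).exp.hasDerivWithinAt
    rw [hCeq t ht] at h
    exact h.congr_deriv (by ring)
  have hconst := constant_of_has_deriv_right_zero
    (fun t ht => (hG t ht).continuousWithinAt)
    (fun t ht => (hG t (Ico_subset_Icc_self ht)).mono_of_mem_nhdsWithin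
      (Icc_mem_nhdsGE_of_mem ht))
  intro t ht
  have h := hconst t ht
  have hF0 : F 0 = 0 := by simp [hF]
  simp only [hF0, Real.exp_zero, mul_one] at h
  exact pos_of_mul_pos_left (h ▸ hγ0) (Real.exp_pos _).le

/-- Riccati bound on the posterior variance when the signaling coefficient is at
least `1/2`: `γ(T) ≤ 4σY²γ°/(4σY² + γ°T)`, which tends to `0` as the horizon
grows (full asymptotic learning in the no-feedback equilibrium). -/
theorem stmt_12 (T σY γo : ℝ) (hT : 0 < T) (hσY : 0 < σY) (hγo : 0 < γo)
    (α γ : ℝ → ℝ)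
    (hα : ContinuousOn α (Icc 0 T))
    (hαhalf : ∀ t ∈ Icc (0:ℝ) T, 1/2 ≤ α t)
    (hγC1 : ContDiffOn ℝ 1 γ (Icc 0 T))
    (hγ0 : γ 0 = γo)
    (hγode : ∀ t ∈ Icc (0:ℝ) T,
      HasDerivWithinAt γ (-(α t)^2 * (γ t)^2 / σY^2) (Icc 0 T) t) :
    (∀ t ∈ Icc (0:ℝ) T, 0 < γ t) ∧
    γ T ≤ 4 * σY^2 * γo / (4 * σY^2 + γo * T) ∧
    Tendsto (fun S : ℝ => 4 * σY^2 * γo / (4 * σY^2 + γo * S)) atTop (nhds 0) := by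
  have hpos : ∀ t ∈ Icc (0:ℝ) T, 0 < γ t :=
    pos_of_hasDerivWithinAt_neg_mul hT.le (c := fun t => (α t)^2 * γ t / σY^2)
      (((hα.pow 2).mul hγC1.continuousOn).div_const _) (hγ0 ▸ hγo)
      (fun t ht => (hγode t ht).congr_deriv (by ring))
  refine ⟨hpos, ?_, ?_⟩
  · have hderiv : ∀ t ∈ Icc (0:ℝ) T, HasDerivWithinAt (fun t => (γ t)⁻¹ - t * (1 / (4 * σY^2)))
        ((α t)^2 / σY^2 - 1 / (4 * σY^2)) (Icc 0 T) t := fun t ht => by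
      have hne := (hpos t ht).ne'
      refine (((hγode t ht).fun_inv hne).sub
        ((hasDerivWithinAt_id t _).mul_const (1 / (4 * σY^2)))).congr_deriv ?_
      field_simp
    have hmono : MonotoneOn (fun t => (γ t)⁻¹ - t * (1 / (4 * σY^2))) (Icc 0 T) := by
      refine monotoneOn_of_hasDerivWithinAt_nonneg (convex_Icc 0 T)
        (fun t ht => (hderiv t ht).continuousWithinAt)
        (fun t ht => (hderiv t (interior_subset ht)).mono interior_subset) fun t ht => ?_
      have h := hαhalf t (interior_subset ht)
      rw [sub_nonneg, div_le_div_iff₀ (by positivity) (by positivity)]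
      have h4 : 1 ≤ 4 * (α t)^2 := by nlinarith
      nlinarith [mul_le_mul_of_nonneg_right h4 (sq_nonneg σY)]
    have h := hmono (left_mem_Icc.2 hT.le) (right_mem_Icc.2 hT.le) hT.le
    have hγT := hpos T (right_mem_Icc.2 hT.le)
    simp only [hγ0, zero_mul, sub_zero] at h
    have hinv : (4 * σY^2 * γo / (4 * σY^2 + γo * T))⁻¹ ≤ (γ T)⁻¹ := by
      calc (4 * σY^2 * γo / (4 * σY^2 + γo * T))⁻¹ = γo⁻¹ + T * (1 / (4 * σY^2)) := by
            field_simp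
        _ ≤ (γ T)⁻¹ := by linarith
    exact (inv_le_inv₀ (by positivity) hγT).1 hinv
  · exact (tendsto_atTop_add_const_left _ _ (tendsto_id.const_mul_atTop hγo)).const_div_atTop _
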